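/- arXiv:1703.03187 — 4 statements merged into one kernel-verified Lean document; each statement's English description precedes it below -/
import Mathlib

section
/- Uniqueness of the Weylian affine connection: let (g, φ) be a Weylian metric on U and let Γ′ be any smooth family of connection coefficients on U that is symmetric in its lower indices (Γ′^μ_{νλ} = Γ′^μ_{λν}) and satisfies the Weyl compatibility condition ∂_λ g_{μν} − Γ′^κ_{λμ} g_{κν} − Γ′^κ_{λν} g_{μκ} = −2 φ_λ g_{μν} on U. Then Γ′ coincides with the Weylian affine connection of (g, φ): Γ′^μ_{νλ} = _gΓ^μ_{νλ} + δ^μ_ν φ_λ + δ^μ_λ φ_ν − g_{νλ} φ^μ. -/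
noncomputable section

open scoped BigOperators

/-- Partial derivative `∂_μ f` of a real-valued function on `ℝⁿ`. -/
def pd {n : ℕ} (μ : Fin n) (f : (Fin n → ℝ) → ℝ) : (Fin n → ℝ) → ℝ :=
  fun x => fderiv ℝ f x (Pi.single μ 1)

/-- Partial derivative `∂_μ f` of a complex-valued function on `ℝⁿ`. -/
def pdC {n : ℕ} (μ : Fin n) (f : (Fin n → ℝ) → ℂ) : (Fin n → ℝ) → ℂ :=
  fun x => fderiv ℝ f x (Pi.single μ 1)

/-- Christoffel symbols `_gΓ^μ_{νλ}` of the metric `g` (with inverse `ginv`). -/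
def christoffel {n : ℕ} (g ginv : (Fin n → ℝ) → Fin n → Fin n → ℝ)
    (μ ν lam : Fin n) (x : Fin n → ℝ) : ℝ :=
  (1/2) * ∑ κ, ginv x μ κ *
    (pd ν (fun y => g y κ lam) x + pd lam (fun y => g y κ ν) x - pd κ (fun y => g y ν lam) x)

/-- Weylian affine connection `Γ^μ_{νλ}` of the Weylian metric `(g, φ)`:
`Γ^μ_{νλ} = _gΓ^μ_{νλ} + δ^μ_ν φ_λ + δ^μ_λ φ_ν − g_{νλ} φ^μ`. -/
def weylConn {n : ℕ} (g ginv : (Fin n → ℝ) → Fin n → Fin n → ℝ)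
    (φ : (Fin n → ℝ) → Fin n → ℝ) (μ ν lam : Fin n) (x : Fin n → ℝ) : ℝ :=
  christoffel g ginv μ ν lam x
    + (if ν = μ then φ x lam else 0) + (if lam = μ then φ x ν else 0)
    - g x ν lam * ∑ κ, ginv x μ κ * φ x κ

/-- Curvature tensor `R^μ_{νλκ}` of a family of connection coefficients `Γ`. -/
def curvOf {n : ℕ} (Γ : (Fin n → ℝ) → Fin n → Fin n → Fin n → ℝ)
    (μ ν lam κ : Fin n) (x : Fin n → ℝ) : ℝ :=
  pd lam (fun y => Γ y μ ν κ) x - pd κ (fun y => Γ y μ ν lam) x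
    + ∑ σ, Γ x μ lam σ * Γ x σ ν κ - ∑ σ, Γ x μ κ σ * Γ x σ ν lam

/-- Ricci tensor `R_{νκ} = R^μ_{νμκ}`. -/
def ricciOf {n : ℕ} (Γ : (Fin n → ℝ) → Fin n → Fin n → Fin n → ℝ)
    (ν κ : Fin n) (x : Fin n → ℝ) : ℝ :=
  ∑ μ, curvOf Γ μ ν μ κ x

/-- Scalar curvature `R = g^{νκ} R_{νκ}`. -/
def scalarOf {n : ℕ} (ginv : (Fin n → ℝ) → Fin n → Fin n → ℝ)
    (Γ : (Fin n → ℝ) → Fin n → Fin n → Fin n → ℝ) (x : Fin n → ℝ) : ℝ :=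
  ∑ ν, ∑ κ, ginv x ν κ * ricciOf Γ ν κ x

/-- Volume factor `√|det g|`. -/
def volFac {n : ℕ} (g : (Fin n → ℝ) → Fin n → Fin n → ℝ) (x : Fin n → ℝ) : ℝ :=
  Real.sqrt |Matrix.det (Matrix.of (g x))|

/-- Laplace–Beltrami operator `Δ_g f = (1/√|det g|) ∂_μ ( √|det g| g^{μν} ∂_ν f )`. -/
def laplaceBeltrami {n : ℕ} (g ginv : (Fin n → ℝ) → Fin n → Fin n → ℝ)
    (f : (Fin n → ℝ) → ℝ) (x : Fin n → ℝ) : ℝ :=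
  (volFac g x)⁻¹ * ∑ μ, pd μ (fun y => volFac g y * ∑ ν, ginv y μ ν * pd ν f y) x

/-- Minkowski matrix `η = diag(1, −1, −1, −1)`. -/
def etaM : Fin 4 → Fin 4 → ℝ :=
  fun μ ν => if μ = ν then (if μ = 0 then 1 else -1) else 0

/-- A right inverse of a finite square array of reals is also a left inverse. -/
theorem sum_mul_eq_ite_comm {n : ℕ} {A B : Fin n → Fin n → ℝ}
    (h : ∀ μ ν, ∑ κ, A μ κ * B κ ν = if μ = ν then (1 : ℝ) else 0) (μ ν : Fin n) :
    ∑ κ, B μ κ * A κ ν = if μ = ν then (1 : ℝ) else 0 := by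
  have hAB : Matrix.of A * Matrix.of B = 1 := by
    ext i j
    simpa [Matrix.mul_apply, Matrix.one_apply] using h i j
  have hBA : (Matrix.of B * Matrix.of A) μ ν = (1 : Matrix (Fin n) (Fin n) ℝ) μ ν := by
    rw [mul_eq_one_comm.mp hAB]
  simpa [Matrix.mul_apply, Matrix.one_apply] using hBA

/-- Lowering an index and raising it again gives back the original components. -/
theorem sum_raise_lower {n : ℕ} {A B : Fin n → Fin n → ℝ}
    (h : ∀ μ ν, ∑ κ, B μ κ * A κ ν = if μ = ν then (1 : ℝ) else 0)
    (v : Fin n → ℝ) (μ : Fin n) :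
    ∑ κ, B μ κ * ∑ a, v a * A κ a = v μ := by
  calc ∑ κ, B μ κ * ∑ a, v a * A κ a
      = ∑ a, v a * ∑ κ, B μ κ * A κ a := by
        simp only [Finset.mul_sum]
        rw [Finset.sum_comm]
        exact Finset.sum_congr rfl fun _ _ => Finset.sum_congr rfl fun _ _ => by ring
    _ = v μ := by simp [h]

/-- Uniqueness of the Weylian affine connection: any smooth family of
connection coefficients `Γ'` on `U` that is symmetric in its lower indices and satisfies the
Weyl compatibility condition coincides with the Weylian affine connection of `(g, φ)`. -/
theorem weyl_connection_unique {n : ℕ} (hn : 2 ≤ n)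
    (U : Set (Fin n → ℝ)) (hU : IsOpen U) (hUne : U.Nonempty)
    (g ginv : (Fin n → ℝ) → Fin n → Fin n → ℝ)
    (φ : (Fin n → ℝ) → Fin n → ℝ)
    (hg : ∀ μ ν, ContDiffOn ℝ (⊤ : ℕ∞) (fun x => g x μ ν) U)
    (hginv : ∀ μ ν, ContDiffOn ℝ (⊤ : ℕ∞) (fun x => ginv x μ ν) U)
    (hsym : ∀ x ∈ U, ∀ μ ν, g x μ ν = g x ν μ)
    (hinv : ∀ x ∈ U, ∀ μ ν, ∑ κ, g x μ κ * ginv x κ ν = if μ = ν then (1:ℝ) else 0)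
    (hφ : ∀ μ, ContDiffOn ℝ (⊤ : ℕ∞) (fun x => φ x μ) U)
    (Γ' : (Fin n → ℝ) → Fin n → Fin n → Fin n → ℝ)
    (hΓ'smooth : ∀ μ ν lam, ContDiffOn ℝ (⊤ : ℕ∞) (fun x => Γ' x μ ν lam) U)
    (hΓ'sym : ∀ x ∈ U, ∀ μ ν lam, Γ' x μ ν lam = Γ' x μ lam ν)
    (hcompat : ∀ x ∈ U, ∀ lam μ ν : Fin n,
      pd lam (fun y => g y μ ν) x
          - (∑ κ, Γ' x κ lam μ * g x κ ν) - (∑ κ, Γ' x κ lam ν * g x μ κ)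
        = -2 * φ x lam * g x μ ν) :
    ∀ x ∈ U, ∀ μ ν lam : Fin n, Γ' x μ ν lam = weylConn g ginv φ μ ν lam x := by
  intro x hx μ ν lam
  have hleft := sum_mul_eq_ite_comm (hinv x hx)
  have key : ∀ κ, pd ν (fun y => g y κ lam) x + pd lam (fun y => g y κ ν) x
      - pd κ (fun y => g y ν lam) x
      = 2 * (∑ a, Γ' x a ν lam * g x κ a) - 2 * φ x ν * g x κ lam - 2 * φ x lam * g x κ ν
        + 2 * φ x κ * g x ν lam := by
    intro κ
    have lower : ∀ p q r, ∑ a, Γ' x a p q * g x a r = ∑ a, Γ' x a p q * g x r a :=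
      fun p q r => Finset.sum_congr rfl fun a _ => by rw [hsym x hx a r]
    have swap : ∀ p q r, ∑ a, Γ' x a p q * g x r a = ∑ a, Γ' x a q p * g x r a :=
      fun p q r => Finset.sum_congr rfl fun a _ => by rw [hΓ'sym x hx a p q]
    have h1 := hcompat x hx ν κ lam
    have h2 := hcompat x hx lam κ ν
    have h3 := hcompat x hx κ ν lam
    rw [lower] at h1 h2 h3
    linarith [swap ν κ lam, swap lam ν κ, swap lam κ ν]
  have hΓ := sum_raise_lower hleft (fun a => Γ' x a ν lam) μ
  have hchr : christoffel g ginv μ ν lam x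
      = (∑ κ, ginv x μ κ * ∑ a, Γ' x a ν lam * g x κ a)
        - φ x ν * (∑ κ, ginv x μ κ * g x κ lam) - φ x lam * (∑ κ, ginv x μ κ * g x κ ν)
        + g x ν lam * ∑ κ, ginv x μ κ * φ x κ := by
    simp only [christoffel, key]
    rw [Finset.mul_sum, Finset.mul_sum Finset.univ _ (φ x ν),
      Finset.mul_sum Finset.univ _ (φ x lam), Finset.mul_sum Finset.univ _ (g x ν lam),
      ← Finset.sum_sub_distrib, ← Finset.sum_sub_distrib, ← Finset.sum_add_distrib]
    exact Finset.sum_congr rfl fun _ _ => by ring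
  rw [weylConn, hchr, hΓ, hleft, hleft]
  simp only [eq_comm (a := μ), mul_ite, mul_one, mul_zero]
  ring
end
end

section
/- Scale behaviour of Weyl geometric curvature: for every Weylian metric (g, φ) on U and every rescaling by a smooth ω : U → ℝ, the curvature tensor and the Ricci tensor of the Weylian affine connection are scale invariant, R̃^μ_{νλκ} = R^μ_{νλκ} and R̃_{νκ} = R_{νκ}, while the Weylian scalar curvature is scale covariant of weight −2: R̃ = e^{−2ω} R at every point of U. -/
noncomputable section

open scoped BigOperators

/-- The partial derivative at `x` depends only on the germ of the function at `x`. -/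
theorem pd_congr_of_eventuallyEq {n : ℕ} {μ : Fin n} {f h : (Fin n → ℝ) → ℝ} {x : Fin n → ℝ}
    (H : f =ᶠ[nhds x] h) : pd μ f x = pd μ h x := by
  rw [pd, pd, H.fderiv_eq]

/-- Partial derivative of a function rescaled by `exp (2 * ω)`. -/
theorem pd_exp_two_mul {n : ℕ} (μ : Fin n) {ω f : (Fin n → ℝ) → ℝ} {x : Fin n → ℝ}
    (hω : DifferentiableAt ℝ ω x) (hf : DifferentiableAt ℝ f x) :
    pd μ (fun y => Real.exp (2 * ω y) * f y) x
      = Real.exp (2 * ω x) * (2 * pd μ ω x * f x + pd μ f x) := by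
  have h := (((hω.hasFDerivAt.const_mul 2).exp).mul hf.hasFDerivAt).fderiv
  have h' : fderiv ℝ (fun y => Real.exp (2 * ω y) * f y) x = _ := h
  simp only [pd, h', add_apply, smul_apply, smul_eq_mul]
  ring

/-- Connections that agree near `x` have the same curvature tensor at `x`. -/
theorem curvOf_congr {n : ℕ} {Γ Γ' : (Fin n → ℝ) → Fin n → Fin n → Fin n → ℝ} {x : Fin n → ℝ}
    (H : Γ =ᶠ[nhds x] Γ') (μ ν lam κ : Fin n) :
    curvOf Γ μ ν lam κ x = curvOf Γ' μ ν lam κ x := by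
  have hpd : ∀ ρ a b c, pd ρ (fun y => Γ y a b c) x = pd ρ (fun y => Γ' y a b c) x :=
    fun ρ a b c => pd_congr_of_eventuallyEq (H.mono fun y hy => by simp only [hy])
  simp only [curvOf, hpd, H.eq_of_nhds]

/-- A right inverse of the metric is also a left inverse. -/
theorem sum_inv_mul_metric {n : ℕ} {g ginv : Fin n → Fin n → ℝ}
    (hinv : ∀ μ ν, ∑ κ, g μ κ * ginv κ ν = if μ = ν then (1 : ℝ) else 0) (μ ν : Fin n) :
    ∑ κ, ginv μ κ * g κ ν = if μ = ν then (1 : ℝ) else 0 := by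
  have h : Matrix.of g * Matrix.of ginv = 1 := by
    ext i j
    simpa [Matrix.mul_apply, Matrix.one_apply] using hinv i j
  have h' := Matrix.ext_iff.mpr (mul_eq_one_comm.mp h) μ ν
  simpa [Matrix.mul_apply, Matrix.one_apply] using h'

/-- The Weylian affine connection is scale invariant. -/
theorem weylConn_rescale {n : ℕ} {g ginv gt gtinv : (Fin n → ℝ) → Fin n → Fin n → ℝ}
    {φ φt : (Fin n → ℝ) → Fin n → ℝ} {ω : (Fin n → ℝ) → ℝ} {x : Fin n → ℝ}
    (hg : ∀ μ ν, DifferentiableAt ℝ (fun y => g y μ ν) x)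
    (hinv : ∀ μ ν, ∑ κ, g x μ κ * ginv x κ ν = if μ = ν then (1 : ℝ) else 0)
    (hω : DifferentiableAt ℝ ω x)
    (hgt : ∀ y μ ν, gt y μ ν = Real.exp (2 * ω y) * g y μ ν)
    (hgtinv : ∀ μ ν, gtinv x μ ν = Real.exp (-2 * ω x) * ginv x μ ν)
    (hφt : ∀ μ, φt x μ = φ x μ - pd μ ω x) (μ ν lam : Fin n) :
    weylConn gt gtinv φt μ ν lam x = weylConn g ginv φ μ ν lam x := by
  have hexp : Real.exp (-2 * ω x) * Real.exp (2 * ω x) = 1 := by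
    rw [← Real.exp_add]
    simp
  have hchr : christoffel gt gtinv μ ν lam x = christoffel g ginv μ ν lam x
      + pd ν ω x * (if μ = lam then 1 else 0) + pd lam ω x * (if μ = ν then 1 else 0)
      - g x ν lam * ∑ κ, ginv x μ κ * pd κ ω x := by
    simp only [christoffel, hgt, pd_exp_two_mul _ hω (hg _ _), hgtinv,
      ← sum_inv_mul_metric hinv, Finset.mul_sum, ← Finset.sum_add_distrib,
      ← Finset.sum_sub_distrib]
    refine Finset.sum_congr rfl fun κ _ => ?_
    linear_combination (ginv x μ κ * (pd ν ω x * g x κ lam + pd lam ω x * g x κ ν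
      - pd κ ω x * g x ν lam + (1 / 2) * (pd ν (fun y => g y κ lam) x
      + pd lam (fun y => g y κ ν) x - pd κ (fun y => g y ν lam) x))) * hexp
  have hraise : gt x ν lam * ∑ κ, gtinv x μ κ * φt x κ
      = g x ν lam * ∑ κ, ginv x μ κ * φ x κ - g x ν lam * ∑ κ, ginv x μ κ * pd κ ω x := by
    simp only [hgt, hgtinv, hφt, Finset.mul_sum, ← Finset.sum_sub_distrib]
    refine Finset.sum_congr rfl fun κ _ => ?_
    linear_combination (g x ν lam * ginv x μ κ * (φ x κ - pd κ ω x)) * hexp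
  rw [weylConn, hchr, hraise, hφt, hφt, weylConn]
  simp only [eq_comm (a := μ)]
  split_ifs <;> ring

/-- Scale behaviour of Weyl geometric curvature: under a rescaling by `ω`,
the curvature tensor and the Ricci tensor of the Weylian affine connection are scale
invariant, while the Weylian scalar curvature is scale covariant of weight `−2`:
`R̃ = e^{−2ω} R` on `U`. -/
theorem weyl_curvature_scale_behaviour {n : ℕ} (hn : 2 ≤ n)
    (U : Set (Fin n → ℝ)) (hU : IsOpen U) (hUne : U.Nonempty)
    (g ginv : (Fin n → ℝ) → Fin n → Fin n → ℝ)
    (φ : (Fin n → ℝ) → Fin n → ℝ)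
    (hg : ∀ μ ν, ContDiffOn ℝ (⊤ : ℕ∞) (fun x => g x μ ν) U)
    (hginv : ∀ μ ν, ContDiffOn ℝ (⊤ : ℕ∞) (fun x => ginv x μ ν) U)
    (hsym : ∀ x ∈ U, ∀ μ ν, g x μ ν = g x ν μ)
    (hinv : ∀ x ∈ U, ∀ μ ν, ∑ κ, g x μ κ * ginv x κ ν = if μ = ν then (1:ℝ) else 0)
    (hφ : ∀ μ, ContDiffOn ℝ (⊤ : ℕ∞) (fun x => φ x μ) U)
    (ω : (Fin n → ℝ) → ℝ) (hω : ContDiffOn ℝ (⊤ : ℕ∞) ω U)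
    (gt gtinv : (Fin n → ℝ) → Fin n → Fin n → ℝ)
    (φt : (Fin n → ℝ) → Fin n → ℝ)
    (hgt : ∀ y μ ν, gt y μ ν = Real.exp (2 * ω y) * g y μ ν)
    (hgtinv : ∀ y μ ν, gtinv y μ ν = Real.exp (-2 * ω y) * ginv y μ ν)
    (hφt : ∀ y μ, φt y μ = φ y μ - pd μ ω y) :
    ∀ x ∈ U,
      (∀ μ ν lam κ : Fin n,
          curvOf (fun y a b c => weylConn gt gtinv φt a b c y) μ ν lam κ x
            = curvOf (fun y a b c => weylConn g ginv φ a b c y) μ ν lam κ x)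
      ∧ (∀ ν κ : Fin n,
          ricciOf (fun y a b c => weylConn gt gtinv φt a b c y) ν κ x
            = ricciOf (fun y a b c => weylConn g ginv φ a b c y) ν κ x)
      ∧ scalarOf gtinv (fun y a b c => weylConn gt gtinv φt a b c y) x
          = Real.exp (-2 * ω x) * scalarOf ginv (fun y a b c => weylConn g ginv φ a b c y) x := by
  intro x hx
  have hΓ : (fun y a b c => weylConn gt gtinv φt a b c y)
      =ᶠ[nhds x] fun y a b c => weylConn g ginv φ a b c y := by
    filter_upwards [hU.mem_nhds hx] with y hy
    have hyU := hU.mem_nhds hy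
    funext a b c
    exact weylConn_rescale
      (fun μ ν => ((hg μ ν).contDiffAt hyU).differentiableAt (by simp))
      (hinv y hy) ((hω.contDiffAt hyU).differentiableAt (by simp)) hgt (hgtinv y) (hφt y) a b c
  have hric : ∀ ν κ : Fin n,
      ricciOf (fun y a b c => weylConn gt gtinv φt a b c y) ν κ x
        = ricciOf (fun y a b c => weylConn g ginv φ a b c y) ν κ x := fun ν κ =>
    Finset.sum_congr rfl fun μ _ => curvOf_congr hΓ μ ν μ κ
  refine ⟨curvOf_congr hΓ, hric, ?_⟩
  simp only [scalarOf, hric, hgtinv, Finset.mul_sum, mul_assoc]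
end
end

section
/- Decomposition of the Weylian scalar curvature: for every Weylian metric (g, φ) on U, the scalar curvature R of the Weylian affine connection satisfies, at every point of U, R = _gR − (n−1)(n−2) g^{μν} φ_μ φ_ν − 2(n−1) _g∇_μ φ^μ, where _gR is the Riemannian scalar curvature of g and φ^μ = g^{μκ} φ_κ. -/
noncomputable section

open scoped BigOperators

/-- Riemannian divergence `_g∇_μ V^μ = ∂_μ V^μ + _gΓ^μ_{μκ} V^κ` of a vector field `V`. -/
def riemDiv {n : ℕ} (g ginv : (Fin n → ℝ) → Fin n → Fin n → ℝ)
    (V : (Fin n → ℝ) → Fin n → ℝ) (x : Fin n → ℝ) : ℝ :=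
  (∑ μ, pd μ (fun y => V y μ) x) + ∑ μ, ∑ κ, christoffel g ginv μ μ κ x * V x κ

section PartialDerivative

variable {n : ℕ} {f f₁ f₂ : (Fin n → ℝ) → ℝ} {x : Fin n → ℝ}

theorem pd_add (μ : Fin n) (h₁ : DifferentiableAt ℝ f₁ x) (h₂ : DifferentiableAt ℝ f₂ x) :
    pd μ (fun y => f₁ y + f₂ y) x = pd μ f₁ x + pd μ f₂ x := by
  simp [pd, fderiv_fun_add h₁ h₂]

theorem pd_sub (μ : Fin n) (h₁ : DifferentiableAt ℝ f₁ x) (h₂ : DifferentiableAt ℝ f₂ x) :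
    pd μ (fun y => f₁ y - f₂ y) x = pd μ f₁ x - pd μ f₂ x := by
  simp [pd, fderiv_fun_sub h₁ h₂]

theorem pd_mul (μ : Fin n) (h₁ : DifferentiableAt ℝ f₁ x) (h₂ : DifferentiableAt ℝ f₂ x) :
    pd μ (fun y => f₁ y * f₂ y) x = pd μ f₁ x * f₂ x + f₁ x * pd μ f₂ x := by
  simp [pd, fderiv_fun_mul h₁ h₂]
  ring

theorem pd_sum {ι : Type*} (s : Finset ι) (μ : Fin n) {F : ι → (Fin n → ℝ) → ℝ}
    (h : ∀ i ∈ s, DifferentiableAt ℝ (F i) x) :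
    pd μ (fun y => ∑ i ∈ s, F i y) x = ∑ i ∈ s, pd μ (F i) x := by
  simp [pd, fderiv_fun_sum h]

theorem pd_ite (μ : Fin n) (c : Prop) [Decidable c] (f : (Fin n → ℝ) → ℝ) (x : Fin n → ℝ) :
    pd μ (fun y => if c then f y else 0) x = if c then pd μ f x else 0 := by
  split_ifs <;> simp [pd]

theorem pd_congr {U : Set (Fin n → ℝ)} (hU : IsOpen U) (hx : x ∈ U)
    (h : ∀ y ∈ U, f₁ y = f₂ y) (μ : Fin n) : pd μ f₁ x = pd μ f₂ x := by
  have : f₁ =ᶠ[nhds x] f₂ := Filter.eventually_of_mem (hU.mem_nhds hx) h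
  simp only [pd, this.fderiv_eq]

theorem ContDiffOn.differentiableAt_pd {U : Set (Fin n → ℝ)} (hU : IsOpen U) (hx : x ∈ U)
    (h : ContDiffOn ℝ (⊤ : ℕ∞) f U) (μ : Fin n) : DifferentiableAt ℝ (pd μ f) x := by
  have h1 : ContDiffOn ℝ 1 (fderiv ℝ f) U := 
    h.fderiv_of_isOpen hU (WithTop.coe_le_coe.mpr (le_top : (1 + 1 : ℕ∞) ≤ ⊤))
  have h2 : DifferentiableAt ℝ (fderiv ℝ f) x :=
    (h1.differentiableOn one_ne_zero).differentiableAt (hU.mem_nhds hx)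
  exact h2.clm_apply (differentiableAt_const _)

end PartialDerivative

section Contraction

variable {ι : Type*}

/-- The difference `δ^μ_ν φ_λ + δ^μ_λ φ_ν − g_{νλ} p^μ` between the Weylian connection and the
Levi-Civita connection. -/
def weylShift [DecidableEq ι] (g : ι → ι → ℝ) (φ p : ι → ℝ) (μ ν lam : ι) : ℝ :=
  (if ν = μ then φ lam else 0) + (if lam = μ then φ ν else 0) - g ν lam * p μ

variable {g h : ι → ι → ℝ} {φ p : ι → ℝ} {dg A : ι → ι → ι → ℝ}

theorem weylShift_symm [DecidableEq ι] (hg : ∀ μ ν, g μ ν = g ν μ) (μ ν lam : ι) :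
    weylShift g φ p μ ν lam = weylShift g φ p μ lam ν := by
  simp only [weylShift, hg ν lam]
  ring

variable [Fintype ι]

theorem sum_inverse_mul_sum_trace_mul {T : ι → ι → ι → ℝ} :
    ∑ ν, ∑ κ, h ν κ * ∑ μ, ∑ σ, T μ μ σ * A σ ν κ =
      ∑ σ, (∑ μ, T μ μ σ) * ∑ ν, ∑ κ, h ν κ * A σ ν κ := by
  simp only [Finset.mul_sum, Finset.sum_mul]
  rw [Finset.sum_congr rfl fun ν _ => (Finset.sum_congr rfl fun κ _ => Finset.sum_comm).trans
    Finset.sum_comm, Finset.sum_comm]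
  refine Finset.sum_congr rfl fun σ _ => Finset.sum_congr rfl fun ν _ =>
    Finset.sum_congr rfl fun κ _ => Finset.sum_congr rfl fun μ _ => ?_
  ring

/-- `h^{νκ} ∂_μ g_{νκ} = 2 Γ^ν_{νμ}`. -/
theorem two_mul_sum_christoffel (hh : ∀ μ ν, h μ ν = h ν μ)
    (hdg : ∀ κ μ ν, dg κ μ ν = dg κ ν μ)
    (hA : ∀ μ ν lam, A μ ν lam = 1 / 2 * ∑ κ, h μ κ * (dg ν κ lam + dg lam κ ν - dg κ ν lam))
    (σ : ι) : 2 * ∑ μ, A μ μ σ = ∑ ν, ∑ κ, h ν κ * dg σ ν κ := by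
  have e : ∑ μ, ∑ κ, h μ κ * dg κ μ σ = ∑ μ, ∑ κ, h μ κ * dg μ κ σ := by
    rw [Finset.sum_comm]
    exact Finset.sum_congr rfl fun κ _ => Finset.sum_congr rfl fun ν _ => by rw [hh]
  have e₂ : ∑ μ, ∑ κ, h μ κ * dg σ κ μ = ∑ μ, ∑ κ, h μ κ * dg σ μ κ :=
    Finset.sum_congr rfl fun κ _ => Finset.sum_congr rfl fun ν _ => by rw [hdg]
  simp only [hA, ← Finset.mul_sum, mul_add, mul_sub, Finset.sum_add_distrib,
    Finset.sum_sub_distrib, e, e₂]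
  ring

variable [DecidableEq ι]

theorem sum_weylShift (hp : ∀ μ, φ μ = ∑ κ, g μ κ * p κ) (ν : ι) :
    ∑ μ, weylShift g φ p μ ν μ = Fintype.card ι * φ ν := by
  simp [weylShift, Finset.sum_add_distrib, Finset.sum_sub_distrib, ← hp]

theorem sum_inverse_mul_metric (hg : ∀ μ ν, g μ ν = g ν μ)
    (hgh : ∀ μ ν, ∑ κ, g μ κ * h κ ν = if μ = ν then (1 : ℝ) else 0) :
    ∑ ν, ∑ κ, h ν κ * g ν κ = Fintype.card ι := by
  rw [Finset.sum_comm]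
  have : ∀ κ, ∑ ν, h ν κ * g ν κ = 1 := fun κ => by
    simpa [hg κ, mul_comm] using hgh κ κ
  simp [this]

theorem sum_inverse_mul_weylShift (hg : ∀ μ ν, g μ ν = g ν μ) (hh : ∀ μ ν, h μ ν = h ν μ)
    (hgh : ∀ μ ν, ∑ κ, g μ κ * h κ ν = if μ = ν then (1 : ℝ) else 0)
    (hφ : ∀ μ, p μ = ∑ κ, h μ κ * φ κ) (σ : ι) :
    ∑ ν, ∑ κ, h ν κ * weylShift g φ p σ ν κ = (2 - Fintype.card ι) * p σ := by
  have h3 : ∑ ν, ∑ κ, h ν κ * (g ν κ * p σ) = Fintype.card ι * p σ := by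
    simp only [← mul_assoc, ← Finset.sum_mul, sum_inverse_mul_metric hg hgh]
  have h2 : ∑ ν, h ν σ * φ ν = p σ := by simp only [hφ, hh σ]
  simp only [weylShift, mul_sub, mul_add, Finset.sum_add_distrib, Finset.sum_sub_distrib, h3,
    mul_ite, mul_zero, Finset.sum_ite_irrel, Finset.sum_const_zero, Finset.sum_ite_eq',
    Finset.mem_univ, if_true, h2, ← hφ]
  ring

theorem sum_inverse_mul_mul_weylShift (hg : ∀ μ ν, g μ ν = g ν μ) (hh : ∀ μ ν, h μ ν = h ν μ)
    (hgh : ∀ μ ν, ∑ κ, g μ κ * h κ ν = if μ = ν then (1 : ℝ) else 0)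
    (hφ : ∀ μ, p μ = ∑ κ, h μ κ * φ κ)
    (hA : ∀ μ ν lam, A μ ν lam = A μ lam ν) :
    ∑ ν, ∑ κ, h ν κ * ∑ μ, ∑ σ, A μ κ σ * weylShift g φ p σ ν μ =
      ∑ μ, φ μ * ∑ ν, ∑ κ, h ν κ * A μ ν κ := by
  have e1 : ∑ ν, ∑ κ, h ν κ * ∑ μ, A μ κ ν * φ μ = ∑ μ, φ μ * ∑ ν, ∑ κ, h ν κ * A μ ν κ := by
    simp only [Finset.mul_sum]
    rw [Finset.sum_congr rfl fun ν _ => Finset.sum_comm, Finset.sum_comm]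
    refine Finset.sum_congr rfl fun μ _ => Finset.sum_congr rfl fun ν _ =>
      Finset.sum_congr rfl fun κ _ => ?_
    rw [hA μ κ ν]
    ring
  have e2 : ∑ ν, ∑ κ, h ν κ * ∑ μ, A μ κ μ * φ ν = ∑ κ, (∑ μ, A μ κ μ) * p κ := by
    rw [Finset.sum_comm]
    refine Finset.sum_congr rfl fun κ _ => ?_
    rw [hφ, Finset.mul_sum]
    refine Finset.sum_congr rfl fun ν _ => ?_
    rw [← Finset.sum_mul, hh ν κ]
    ring
  have e3 : ∑ ν, ∑ κ, h ν κ * ∑ μ, ∑ σ, A μ κ σ * (g ν μ * p σ) =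
      ∑ κ, (∑ μ, A μ κ μ) * p κ := by
    have : ∀ κ, ∑ ν, h ν κ * ∑ μ, ∑ σ, A μ κ σ * (g ν μ * p σ) = ∑ σ, A κ κ σ * p σ := by
      intro κ
      simp only [Finset.mul_sum]
      rw [Finset.sum_comm]
      have : ∀ μ, ∑ ν, ∑ σ, h ν κ * (A μ κ σ * (g ν μ * p σ)) =
          if μ = κ then ∑ σ, A μ κ σ * p σ else 0 := by
        intro μ
        rw [← one_mul (∑ σ, A μ κ σ * p σ), ← ite_zero_mul, ← hgh, Finset.sum_mul]
        refine Finset.sum_congr rfl fun ν _ => ?_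
        rw [Finset.mul_sum]
        refine Finset.sum_congr rfl fun σ _ => ?_
        rw [hg μ ν]
        ring
      simp [this]
    rw [Finset.sum_comm, Finset.sum_congr rfl fun κ _ => this κ, Finset.sum_comm]
    simp only [Finset.sum_mul]
    refine Finset.sum_congr rfl fun σ _ => Finset.sum_congr rfl fun κ _ => ?_
    rw [hA κ κ σ]
  simp only [weylShift, mul_sub, mul_add, Finset.sum_add_distrib, Finset.sum_sub_distrib, e3,
    mul_ite, mul_zero, Finset.sum_ite_eq, Finset.mem_univ, if_true, e1, e2]
  ring

theorem sum_inverse_mul_weylShift_mul (hg : ∀ μ ν, g μ ν = g ν μ) (hh : ∀ μ ν, h μ ν = h ν μ)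
    (hgh : ∀ μ ν, ∑ κ, g μ κ * h κ ν = if μ = ν then (1 : ℝ) else 0)
    (hφ : ∀ μ, p μ = ∑ κ, h μ κ * φ κ)
    (hA : ∀ μ ν lam, A μ ν lam = A μ lam ν) :
    ∑ ν, ∑ κ, h ν κ * ∑ μ, ∑ σ, weylShift g φ p μ κ σ * A σ ν μ =
      ∑ μ, φ μ * ∑ ν, ∑ κ, h ν κ * A μ ν κ := by
  rw [← sum_inverse_mul_mul_weylShift hg hh hgh hφ hA, Finset.sum_comm]
  refine Finset.sum_congr rfl fun κ _ => Finset.sum_congr rfl fun ν _ => ?_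
  rw [hh ν κ, Finset.sum_comm]
  refine congrArg _ (Finset.sum_congr rfl fun σ _ => Finset.sum_congr rfl fun μ _ => ?_)
  ring

/-- The scalar contraction of the quadratic terms in the change of curvature from `A` to
`A + weylShift g φ p`. -/
theorem sum_inverse_mul_quadratic (hg : ∀ μ ν, g μ ν = g ν μ) (hh : ∀ μ ν, h μ ν = h ν μ)
    (hgh : ∀ μ ν, ∑ κ, g μ κ * h κ ν = if μ = ν then (1 : ℝ) else 0)
    (hφ : ∀ μ, p μ = ∑ κ, h μ κ * φ κ) (hp : ∀ μ, φ μ = ∑ κ, g μ κ * p κ)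
    (hA : ∀ μ ν lam, A μ ν lam = A μ lam ν) :
    ∑ ν, ∑ κ, h ν κ * ∑ μ, ∑ σ,
        ((A μ μ σ + weylShift g φ p μ μ σ) * (A σ ν κ + weylShift g φ p σ ν κ)
          - (A μ κ σ + weylShift g φ p μ κ σ) * (A σ ν μ + weylShift g φ p σ ν μ)) =
      ∑ ν, ∑ κ, h ν κ * ∑ μ, ∑ σ, (A μ μ σ * A σ ν κ - A μ κ σ * A σ ν μ)
        + (2 - Fintype.card ι) * ∑ σ, (∑ μ, A μ μ σ) * p σ
        + (Fintype.card ι - 2) * ∑ μ, φ μ * ∑ ν, ∑ κ, h ν κ * A μ ν κ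
        - (Fintype.card ι - 1) * (Fintype.card ι - 2) * ∑ μ, φ μ * p μ := by
  have hT : ∀ μ ν lam, weylShift g φ p μ ν lam = weylShift g φ p μ lam ν := weylShift_symm hg
  have trT : ∀ σ, ∑ μ, weylShift g φ p μ μ σ = Fintype.card ι * φ σ := fun σ => by
    rw [← sum_weylShift hp]
    exact Finset.sum_congr rfl fun μ _ => hT _ _ _
  have a1 := sum_inverse_mul_sum_trace_mul (h := h) (T := A) (A := weylShift g φ p)
  have a2 := sum_inverse_mul_sum_trace_mul (h := h) (T := weylShift g φ p) (A := A)
  have a3 := sum_inverse_mul_sum_trace_mul (h := h) (T := weylShift g φ p) (A := weylShift g φ p)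
  have b1 := sum_inverse_mul_mul_weylShift hg hh hgh hφ hA
  have b2 := sum_inverse_mul_weylShift_mul hg hh hgh hφ hA
  have b3 := sum_inverse_mul_mul_weylShift hg hh hgh hφ hT
  simp only [trT, sum_inverse_mul_weylShift hg hh hgh hφ] at a1 a2 a3 b3
  have c1 : ∑ σ, (∑ μ, A μ μ σ) * ((2 - Fintype.card ι) * p σ) =
      (2 - Fintype.card ι) * ∑ σ, (∑ μ, A μ μ σ) * p σ := by
    rw [Finset.mul_sum]
    exact Finset.sum_congr rfl fun σ _ => by ring
  have c2 : ∑ σ, (Fintype.card ι * φ σ) * ∑ ν, ∑ κ, h ν κ * A σ ν κ =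
      Fintype.card ι * ∑ σ, φ σ * ∑ ν, ∑ κ, h ν κ * A σ ν κ := by
    rw [Finset.mul_sum]
    exact Finset.sum_congr rfl fun σ _ => by ring
  have c3 : ∑ σ, (Fintype.card ι * φ σ) * ((2 - Fintype.card ι) * p σ) =
      Fintype.card ι * (2 - Fintype.card ι) * ∑ σ, φ σ * p σ := by
    rw [Finset.mul_sum]
    exact Finset.sum_congr rfl fun σ _ => by ring
  have c4 : ∑ σ, φ σ * ((2 - Fintype.card ι) * p σ) =
      (2 - Fintype.card ι) * ∑ σ, φ σ * p σ := by
    rw [Finset.mul_sum]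
    exact Finset.sum_congr rfl fun σ _ => by ring
  simp only [mul_add, add_mul, mul_sub, Finset.sum_add_distrib, Finset.sum_sub_distrib]
  linear_combination a1 + a2 + a3 - b1 - b2 - b3 + c1 + c2 + c3 - c4

/-- The scalar contraction of the derivative terms in the change of curvature. -/
theorem sum_inverse_mul_deriv (hg : ∀ μ ν, g μ ν = g ν μ) (hh : ∀ μ ν, h μ ν = h ν μ)
    (hgh : ∀ μ ν, ∑ κ, g μ κ * h κ ν = if μ = ν then (1 : ℝ) else 0)
    {dφ dp : ι → ι → ℝ}
    (hdφ : ∀ κ ν, dφ κ ν = ∑ μ, (dg κ ν μ * p μ + g ν μ * dp κ μ)) :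
    ∑ ν, ∑ κ, h ν κ * ∑ μ,
        (((if ν = μ then dφ μ κ else 0) + (if κ = μ then dφ μ ν else 0)
            - (dg μ ν κ * p μ + g ν κ * dp μ μ))
          - ((if ν = μ then dφ κ μ else 0) + (if μ = μ then dφ κ ν else 0)
            - (dg κ ν μ * p μ + g ν μ * dp κ μ))) =
      (2 - Fintype.card ι) * ∑ ν, ∑ κ, h ν κ * dφ κ ν
        - ∑ μ, (∑ ν, ∑ κ, h ν κ * dg μ ν κ) * p μ - Fintype.card ι * ∑ μ, dp μ μ := by
  have e1 : ∑ ν, ∑ κ, h ν κ * dφ ν κ = ∑ ν, ∑ κ, h ν κ * dφ κ ν := by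
    rw [Finset.sum_comm]
    exact Finset.sum_congr rfl fun κ _ => Finset.sum_congr rfl fun ν _ => by rw [hh]
  have e2 : ∑ ν, ∑ κ, h ν κ * ∑ μ, dg μ ν κ * p μ =
      ∑ μ, (∑ ν, ∑ κ, h ν κ * dg μ ν κ) * p μ := by
    simp only [Finset.mul_sum, Finset.sum_mul]
    rw [Finset.sum_congr rfl fun ν _ => Finset.sum_comm, Finset.sum_comm]
    simp only [mul_assoc]
  have e3 : ∑ ν, ∑ κ, h ν κ * (g ν κ * ∑ μ, dp μ μ) = Fintype.card ι * ∑ μ, dp μ μ := by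
    simp only [← mul_assoc, ← Finset.sum_mul, sum_inverse_mul_metric hg hgh]
  have e4 : ∑ ν, ∑ κ, h ν κ * (Fintype.card ι * dφ κ ν) =
      Fintype.card ι * ∑ ν, ∑ κ, h ν κ * dφ κ ν := by
    simp only [Finset.mul_sum]
    exact Finset.sum_congr rfl fun ν _ => Finset.sum_congr rfl fun κ _ => by ring
  have e5 : ∀ κ ν, ∑ μ, dg κ ν μ * p μ + ∑ μ, g ν μ * dp κ μ = dφ κ ν := fun κ ν => by
    rw [hdφ, Finset.sum_add_distrib]
  simp only [Finset.sum_add_distrib, Finset.sum_sub_distrib, e5, Finset.sum_ite_eq,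
    Finset.mem_univ, if_true, Finset.sum_const, Finset.card_univ, nsmul_eq_mul, mul_add, mul_sub,
    ← Finset.mul_sum, e1, e2, e3, e4]
  ring

/-- `φ_μ h^{νκ} Γ^μ_{νκ} = h^{νκ} ∂_κ φ_ν − ∂_μ p^μ − Γ^μ_{μσ} p^σ` for `φ_μ = g_{μν} p^ν`. -/
theorem sum_mul_sum_christoffel (hg : ∀ μ ν, g μ ν = g ν μ) (hh : ∀ μ ν, h μ ν = h ν μ)
    (hgh : ∀ μ ν, ∑ κ, g μ κ * h κ ν = if μ = ν then (1 : ℝ) else 0)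
    (hφ : ∀ μ, p μ = ∑ κ, h μ κ * φ κ)
    (hdg : ∀ κ μ ν, dg κ μ ν = dg κ ν μ) {dφ dp : ι → ι → ℝ}
    (hdφ : ∀ κ ν, dφ κ ν = ∑ μ, (dg κ ν μ * p μ + g ν μ * dp κ μ))
    (hA : ∀ μ ν lam, A μ ν lam = 1 / 2 * ∑ κ, h μ κ * (dg ν κ lam + dg lam κ ν - dg κ ν lam)) :
    ∑ μ, φ μ * ∑ ν, ∑ κ, h ν κ * A μ ν κ =
      ∑ ν, ∑ κ, h ν κ * dφ κ ν - ∑ μ, dp μ μ - ∑ σ, (∑ μ, A μ μ σ) * p σ := by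
  have lower : ∀ ν κ, ∑ μ, φ μ * A μ ν κ =
      1 / 2 * ∑ σ, p σ * (dg ν σ κ + dg κ σ ν - dg σ ν κ) := by
    intro ν κ
    simp only [hA, hφ, Finset.mul_sum, Finset.sum_mul]
    rw [Finset.sum_comm]
    refine Finset.sum_congr rfl fun σ _ => Finset.sum_congr rfl fun μ _ => ?_
    rw [hh μ σ]
    ring
  have e0 : ∑ μ, φ μ * ∑ ν, ∑ κ, h ν κ * A μ ν κ = ∑ ν, ∑ κ, h ν κ * ∑ μ, φ μ * A μ ν κ := by
    simp only [Finset.mul_sum]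
    rw [Finset.sum_comm, Finset.sum_congr rfl fun ν _ => Finset.sum_comm]
    refine Finset.sum_congr rfl fun ν _ => Finset.sum_congr rfl fun κ _ =>
      Finset.sum_congr rfl fun μ _ => by ring
  have e1 : ∑ ν, ∑ κ, h ν κ * ∑ σ, p σ * dg ν σ κ = ∑ ν, ∑ κ, h ν κ * ∑ σ, p σ * dg κ σ ν := by
    rw [Finset.sum_comm]
    exact Finset.sum_congr rfl fun κ _ => Finset.sum_congr rfl fun ν _ => by rw [hh]
  have e2 : ∑ ν, ∑ κ, h ν κ * ∑ σ, p σ * dg σ ν κ = 2 * ∑ σ, (∑ μ, A μ μ σ) * p σ := by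
    rw [Finset.mul_sum]
    simp only [← mul_assoc, two_mul_sum_christoffel hh hdg hA]
    simp only [Finset.mul_sum, Finset.sum_mul]
    rw [Finset.sum_congr rfl fun ν _ => Finset.sum_comm, Finset.sum_comm]
    refine Finset.sum_congr rfl fun ν _ => Finset.sum_congr rfl fun κ _ =>
      Finset.sum_congr rfl fun μ _ => by ring
  have e3 : ∑ ν, ∑ κ, h ν κ * ∑ μ, g ν μ * dp κ μ = ∑ μ, dp μ μ := by
    rw [Finset.sum_comm]
    refine Finset.sum_congr rfl fun κ _ => ?_
    simp only [Finset.mul_sum]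
    rw [Finset.sum_comm]
    have : ∀ μ, ∑ ν, h ν κ * (g ν μ * dp κ μ) = if μ = κ then dp κ μ else 0 := by
      intro μ
      rw [← one_mul (dp κ μ), ← ite_zero_mul, ← hgh, Finset.sum_mul]
      refine Finset.sum_congr rfl fun ν _ => ?_
      rw [hg μ ν]
      ring
    simp [this]
  have e4 : ∑ ν, ∑ κ, h ν κ * ∑ μ, dg κ ν μ * p μ = ∑ ν, ∑ κ, h ν κ * ∑ σ, p σ * dg κ σ ν :=
    Finset.sum_congr rfl fun ν _ => Finset.sum_congr rfl fun κ _ => congrArg _ <|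
      Finset.sum_congr rfl fun σ _ => by rw [hdg, mul_comm]
  have e5 : ∀ F : ι → ι → ℝ, ∑ ν, ∑ κ, h ν κ * (1 / 2 * F ν κ) =
      1 / 2 * ∑ ν, ∑ κ, h ν κ * F ν κ := fun F => by
    simp only [Finset.mul_sum]
    exact Finset.sum_congr rfl fun ν _ => Finset.sum_congr rfl fun κ _ => by ring
  simp only [e0, lower, e5]
  simp only [hdφ, mul_add, mul_sub, Finset.sum_add_distrib, Finset.sum_sub_distrib, e1, e2, e3, e4]
  ring

end Contraction

theorem curvOf_eq_add_sum {n : ℕ} (Γ : (Fin n → ℝ) → Fin n → Fin n → Fin n → ℝ)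
    (μ ν lam κ : Fin n) (x : Fin n → ℝ) :
    curvOf Γ μ ν lam κ x = (pd lam (fun y => Γ y μ ν κ) x - pd κ (fun y => Γ y μ ν lam) x)
      + ∑ σ, (Γ x μ lam σ * Γ x σ ν κ - Γ x μ κ σ * Γ x σ ν lam) := by
  rw [curvOf, Finset.sum_sub_distrib]
  ring

theorem scalarOf_eq_add {n : ℕ} (ginv : (Fin n → ℝ) → Fin n → Fin n → ℝ)
    (Γ : (Fin n → ℝ) → Fin n → Fin n → Fin n → ℝ) (x : Fin n → ℝ) :
    scalarOf ginv Γ x =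
      ∑ ν, ∑ κ, ginv x ν κ * ∑ μ, (pd μ (fun y => Γ y μ ν κ) x - pd κ (fun y => Γ y μ ν μ) x)
      + ∑ ν, ∑ κ, ginv x ν κ *
          ∑ μ, ∑ σ, (Γ x μ μ σ * Γ x σ ν κ - Γ x μ κ σ * Γ x σ ν μ) := by
  simp only [scalarOf, ricciOf, curvOf_eq_add_sum, Finset.sum_add_distrib, mul_add]

/-- Decomposition of the Weylian scalar curvature:
`R = _gR − (n−1)(n−2) g^{μν} φ_μ φ_ν − 2(n−1) _g∇_μ φ^μ` on `U`,
where `φ^μ = g^{μκ} φ_κ`. -/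
theorem weyl_scalar_curvature_decomposition {n : ℕ} (hn : 2 ≤ n)
    (U : Set (Fin n → ℝ)) (hU : IsOpen U) (hUne : U.Nonempty)
    (g ginv : (Fin n → ℝ) → Fin n → Fin n → ℝ)
    (φ : (Fin n → ℝ) → Fin n → ℝ)
    (hg : ∀ μ ν, ContDiffOn ℝ (⊤ : ℕ∞) (fun x => g x μ ν) U)
    (hginv : ∀ μ ν, ContDiffOn ℝ (⊤ : ℕ∞) (fun x => ginv x μ ν) U)
    (hsym : ∀ x ∈ U, ∀ μ ν, g x μ ν = g x ν μ)
    (hinv : ∀ x ∈ U, ∀ μ ν, ∑ κ, g x μ κ * ginv x κ ν = if μ = ν then (1:ℝ) else 0)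
    (hφ : ∀ μ, ContDiffOn ℝ (⊤ : ℕ∞) (fun x => φ x μ) U) :
    ∀ x ∈ U,
      scalarOf ginv (fun y a b c => weylConn g ginv φ a b c y) x
        = scalarOf ginv (fun y a b c => christoffel g ginv a b c y) x
          - ((n : ℝ) - 1) * ((n : ℝ) - 2) * (∑ μ, ∑ ν, ginv x μ ν * φ x μ * φ x ν)
          - 2 * ((n : ℝ) - 1) * riemDiv g ginv (fun y μ => ∑ κ, ginv y μ κ * φ y κ) x := by
  intro x hx
  have diff : ∀ {f : (Fin n → ℝ) → ℝ}, ContDiffOn ℝ (⊤ : ℕ∞) f U → DifferentiableAt ℝ f x :=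
    fun hf => (hf.differentiableOn (by simp)).differentiableAt (hU.mem_nhds hx)
  have hginv_symm : ∀ y ∈ U, ∀ μ ν, ginv y μ ν = ginv y ν μ := by
    intro y hy μ ν
    have h1 : Matrix.of (g y) * Matrix.of (ginv y) = 1 := by
      ext μ ν
      simpa [Matrix.mul_apply, Matrix.one_apply] using hinv y hy μ ν
    have h2 : (Matrix.of (g y)).transpose = Matrix.of (g y) := by
      ext μ ν
      exact hsym y hy ν μ
    have h3 : (Matrix.of (ginv y)).transpose * Matrix.of (g y) = 1 := by
      rw [← h2, ← Matrix.transpose_mul, h1, Matrix.transpose_one]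
    exact congrFun (congrFun (left_inv_eq_right_inv h3 h1).symm μ) ν
  set p : (Fin n → ℝ) → Fin n → ℝ := fun y μ => ∑ κ, ginv y μ κ * φ y κ with p_def
  have hp : ∀ y ∈ U, ∀ μ, φ y μ = ∑ κ, g y μ κ * p y κ := by
    intro y hy μ
    simp only [p_def, Finset.mul_sum]
    rw [Finset.sum_comm]
    simp only [← mul_assoc, ← Finset.sum_mul, hinv y hy]
    simp
  have gd : ∀ μ ν, DifferentiableAt ℝ (fun y => g y μ ν) x := fun μ ν => diff (hg μ ν)
  have φd : ∀ μ, DifferentiableAt ℝ (fun y => φ y μ) x := fun μ => diff (hφ μ)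
  have pdiff : ∀ μ, DifferentiableAt ℝ (fun y => p y μ) x := fun μ =>
    DifferentiableAt.fun_sum fun κ _ => (diff (hginv μ κ)).mul (φd κ)
  have Γd : ∀ μ ν lam, DifferentiableAt ℝ (christoffel g ginv μ ν lam) x := fun μ ν lam =>
    (DifferentiableAt.fun_sum fun κ _ => (diff (hginv μ κ)).mul
      ((((hg κ lam).differentiableAt_pd hU hx ν).add ((hg κ ν).differentiableAt_pd hU hx lam)).sub
        ((hg ν lam).differentiableAt_pd hU hx κ))).const_mul _
  have hdg : ∀ κ μ ν, pd κ (fun y => g y μ ν) x = pd κ (fun y => g y ν μ) x := fun κ μ ν =>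
    pd_congr hU hx (fun y hy => hsym y hy μ ν) κ
  have hdφ : ∀ κ ν, pd κ (fun y => φ y ν) x =
      ∑ μ, (pd κ (fun y => g y ν μ) x * p x μ + g x ν μ * pd κ (fun y => p y μ) x) := by
    intro κ ν
    have d : ∀ μ ∈ Finset.univ, DifferentiableAt ℝ (fun y => g y ν μ * p y μ) x :=
      fun μ _ => (gd ν μ).mul (pdiff μ)
    rw [pd_congr hU hx (fun y hy => hp y hy ν) κ, pd_sum _ _ d]
    exact Finset.sum_congr rfl fun μ _ => pd_mul κ (gd ν μ) (pdiff μ)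
  have conn : ∀ y μ ν lam, weylConn g ginv φ μ ν lam y =
      christoffel g ginv μ ν lam y + weylShift (g y) (φ y) (p y) μ ν lam := by
    intro y μ ν lam
    simp only [weylConn, weylShift, p_def]
    ring
  have ited : ∀ (c : Prop) [Decidable c] μ,
      DifferentiableAt ℝ (fun y => if c then φ y μ else 0) x := by
    intro c _ μ
    split_ifs
    exacts [φd μ, differentiableAt_const _]
  have dconn : ∀ κ μ ν lam, pd κ (fun y => weylConn g ginv φ μ ν lam y) x =
      pd κ (christoffel g ginv μ ν lam) x +
        ((if ν = μ then pd κ (fun y => φ y lam) x else 0)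
          + (if lam = μ then pd κ (fun y => φ y ν) x else 0)
          - (pd κ (fun y => g y ν lam) x * p x μ + g x ν lam * pd κ (fun y => p y μ) x)) := by
    intro κ μ ν lam
    simp only [conn, weylShift]
    rw [pd_add κ (Γd μ ν lam) (((ited _ lam).fun_add (ited _ ν)).fun_sub
        ((gd ν lam).fun_mul (pdiff μ))),
      pd_sub κ ((ited _ lam).fun_add (ited _ ν)) ((gd ν lam).fun_mul (pdiff μ)),
      pd_add κ (ited _ lam) (ited _ ν), pd_mul κ (gd ν lam) (pdiff μ), pd_ite, pd_ite]
  have hΓ : ∀ μ ν lam, christoffel g ginv μ ν lam x = christoffel g ginv μ lam ν x := by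
    intro μ ν lam
    simp only [christoffel]
    refine congrArg _ (Finset.sum_congr rfl fun κ _ => ?_)
    rw [hdg κ ν lam]
    ring
  have hφx : ∀ μ, p x μ = ∑ κ, ginv x μ κ * φ x κ := fun μ => rfl
  have quad := sum_inverse_mul_quadratic (hsym x hx) (hginv_symm x hx) (hinv x hx) hφx
    (hp x hx) hΓ
  have lin := sum_inverse_mul_deriv (hsym x hx) (hginv_symm x hx) (hinv x hx) hdφ
  have tr := two_mul_sum_christoffel (hginv_symm x hx) hdg
    (A := fun μ ν lam => christoffel g ginv μ ν lam x) (fun μ ν lam => rfl)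
  have div := sum_mul_sum_christoffel (hsym x hx) (hginv_symm x hx) (hinv x hx) hφx hdg hdφ
    (A := fun μ ν lam => christoffel g ginv μ ν lam x) (fun μ ν lam => rfl)
  have norm : ∑ μ, φ x μ * p x μ = ∑ μ, ∑ ν, ginv x μ ν * φ x μ * φ x ν := by
    simp only [hφx, Finset.mul_sum]
    exact Finset.sum_congr rfl fun μ _ => Finset.sum_congr rfl fun ν _ => by ring
  have trace : ∑ μ, ∑ κ, christoffel g ginv μ μ κ x * p x κ =
      ∑ σ, (∑ μ, christoffel g ginv μ μ σ x) * p x σ := by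
    rw [Finset.sum_comm]
    simp only [Finset.sum_mul]
  have metric_trace : ∑ μ, (∑ ν, ∑ κ, ginv x ν κ * pd μ (fun y => g y ν κ) x) * p x μ =
      2 * ∑ σ, (∑ μ, christoffel g ginv μ μ σ x) * p x σ := by
    rw [Finset.mul_sum]
    simp only [← tr, mul_assoc]
  have deriv_part : ∑ ν, ∑ κ, ginv x ν κ * ∑ μ,
        (pd μ (fun y => weylConn g ginv φ μ ν κ y) x
          - pd κ (fun y => weylConn g ginv φ μ ν μ y) x) =
      ∑ ν, ∑ κ, ginv x ν κ * ∑ μ,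
        (pd μ (christoffel g ginv μ ν κ) x - pd κ (christoffel g ginv μ ν μ) x) +
      ((2 - n) * ∑ ν, ∑ κ, ginv x ν κ * pd κ (fun y => φ y ν) x
        - 2 * ∑ σ, (∑ μ, christoffel g ginv μ μ σ x) * p x σ
        - n * ∑ μ, pd μ (fun y => p y μ) x) := by
    rw [metric_trace, Fintype.card_fin] at lin
    rw [← lin]
    simp only [dconn, add_sub_add_comm, ← Finset.sum_add_distrib, ← mul_add]
  rw [scalarOf_eq_add, scalarOf_eq_add, deriv_part, riemDiv]
  simp only [conn]
  rw [quad, trace, ← norm, div, Fintype.card_fin]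
  ring
end
end

section
/- Santamato's scale-connection curvature formula: let n ≥ 3, U ⊆ ℝⁿ open nonempty, g a metric on U, ρ : U → ℝ smooth with ρ > 0, and set γ = (n−2)/(4(n−1)) and φ_i = −(n−2)^{−1} ∂_i log ρ. Then the scale-connection part of the (sign-inverted) Weylian scalar curvature satisfies, at every point of U, (n−1)(n−2) g^{ij} φ_i φ_j − 2(n−1) · (1/√|det g|) ∂_i ( √|det g| g^{ij} φ_j ) = γ^{−1} (Δ_g √ρ)/√ρ; i.e. with this choice of scale connection the Weylian curvature contribution reproduces exactly the Bohmian quantum potential term (1/(γ√ρ)) Δ_g √ρ. -/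
noncomputable section

open scoped BigOperators

lemma differentiableAt_pd_sqrt {n : ℕ} {ρ : (Fin n → ℝ) → ℝ} {x : Fin n → ℝ}
    (hρ : ContDiffAt ℝ (⊤ : ℕ∞) ρ x) (hx : 0 < ρ x) (j : Fin n) :
    DifferentiableAt ℝ (pd j (fun y => Real.sqrt (ρ y))) x := by
  have h := (hρ.sqrt hx.ne').fderiv_right (m := 1) (by norm_cast)
  exact (h.differentiableAt one_ne_zero).clm_apply (differentiableAt_const _)

lemma pd_log_eq_pd_sqrt {n : ℕ} {ρ : (Fin n → ℝ) → ℝ} {x : Fin n → ℝ}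
    (hρ : DifferentiableAt ℝ ρ x) (hx : 0 < ρ x) (j : Fin n) :
    pd j (fun y => Real.log (ρ y)) x =
      2 * pd j (fun y => Real.sqrt (ρ y)) x / Real.sqrt (ρ x) := by
  have hs : Real.sqrt (ρ x) ≠ 0 := (Real.sqrt_pos.2 hx).ne'
  unfold pd
  rw [fderiv.log hρ hx.ne', fderiv_sqrt hρ hx.ne']
  simp only [smul_apply, smul_eq_mul]
  nth_rewrite 1 [← Real.sq_sqrt hx.le]
  field_simp

lemma volFac_pos {n : ℕ} {g ginv : (Fin n → ℝ) → Fin n → Fin n → ℝ} {x : Fin n → ℝ}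
    (hinv : ∀ μ ν, ∑ σ, g x μ σ * ginv x σ ν = if μ = ν then (1 : ℝ) else 0) :
    0 < volFac g x := by
  have h : Matrix.of (g x) * Matrix.of (ginv x) = 1 := by
    ext μ ν
    simpa [Matrix.mul_apply, Matrix.one_apply] using hinv μ ν
  exact Real.sqrt_pos.2 (abs_pos.2 (Matrix.det_ne_zero_of_right_inverse h))

lemma volFac_differentiableAt {n : ℕ} {g : (Fin n → ℝ) → Fin n → Fin n → ℝ} {x : Fin n → ℝ}
    (hg : ∀ μ ν, DifferentiableAt ℝ (fun y => g y μ ν) x) (hpos : 0 < volFac g x) :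
    DifferentiableAt ℝ (volFac g) x := by
  have hd : DifferentiableAt ℝ (fun y => Matrix.det (Matrix.of (g y))) x := by
    simp only [Matrix.det_apply, Matrix.of_apply]
    fun_prop
  have h0 : |Matrix.det (Matrix.of (g x))| ≠ 0 := (Real.sqrt_pos.1 hpos).ne'
  exact (hd.abs (abs_ne_zero.1 h0)).sqrt h0

lemma pd_const_mul_div {n : ℕ} {w s : (Fin n → ℝ) → ℝ} {x : Fin n → ℝ} (c : ℝ)
    (hw : DifferentiableAt ℝ w x) (hs : DifferentiableAt ℝ s x) (hx : s x ≠ 0) (i : Fin n) :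
    pd i (fun y => c * (w y / s y)) x =
      c * (pd i w x / s x - w x * pd i s x / s x ^ 2) := by
  have h := ((hw.hasFDerivAt.mul
    ((hasDerivAt_inv hx).comp_hasFDerivAt x hs.hasFDerivAt)).const_mul c).fderiv
  have e : (fun y => c * (w y / s y)) = fun y => c * (w * (Inv.inv ∘ s)) y := by
    funext y
    simp [div_eq_mul_inv]
  unfold pd
  rw [e, h]
  simp only [add_apply, smul_apply, smul_eq_mul, Function.comp_apply]
  field_simp
  ring

/-- Santamato's scale-connection curvature formula: with
`γ = (n−2)/(4(n−1))` and `φ_i = −(n−2)⁻¹ ∂_i log ρ`, the scale-connection part of the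
(sign-inverted) Weylian scalar curvature satisfies
`(n−1)(n−2) g^{ij} φ_i φ_j − 2(n−1) (1/√|det g|) ∂_i( √|det g| g^{ij} φ_j )
  = γ⁻¹ (Δ_g √ρ)/√ρ` on `U`. -/
theorem santamato_curvature_quantum_potential {n : ℕ} (hn : 3 ≤ n)
    (U : Set (Fin n → ℝ)) (hU : IsOpen U) (hUne : U.Nonempty)
    (g ginv : (Fin n → ℝ) → Fin n → Fin n → ℝ)
    (hg : ∀ μ ν, ContDiffOn ℝ (⊤ : ℕ∞) (fun x => g x μ ν) U)
    (hginv : ∀ μ ν, ContDiffOn ℝ (⊤ : ℕ∞) (fun x => ginv x μ ν) U)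
    (hsym : ∀ x ∈ U, ∀ μ ν, g x μ ν = g x ν μ)
    (hinv : ∀ x ∈ U, ∀ μ ν, ∑ σ, g x μ σ * ginv x σ ν = if μ = ν then (1:ℝ) else 0)
    (ρ : (Fin n → ℝ) → ℝ) (hρ : ContDiffOn ℝ (⊤ : ℕ∞) ρ U) (hρpos : ∀ x ∈ U, 0 < ρ x)
    (γ : ℝ) (hγ : γ = ((n : ℝ) - 2) / (4 * ((n : ℝ) - 1)))
    (φ : (Fin n → ℝ) → Fin n → ℝ)
    (hφ : ∀ y i, φ y i = -(((n : ℝ) - 2))⁻¹ * pd i (fun z => Real.log (ρ z)) y) :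
    ∀ x ∈ U,
      ((n : ℝ) - 1) * ((n : ℝ) - 2) * (∑ i, ∑ j, ginv x i j * φ x i * φ x j)
          - 2 * ((n : ℝ) - 1) *
              ((volFac g x)⁻¹ * ∑ i, pd i (fun y => volFac g y * ∑ j, ginv y i j * φ y j) x)
        = γ⁻¹ * laplaceBeltrami g ginv (fun y => Real.sqrt (ρ y)) x / Real.sqrt (ρ x) := by
  have hn2 : (n : ℝ) - 2 ≠ 0 := by
    have : (3 : ℝ) ≤ n := by exact_mod_cast hn
    linarith
  have hn1 : (n : ℝ) - 1 ≠ 0 := by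
    have : (3 : ℝ) ≤ n := by exact_mod_cast hn
    linarith
  intro x hx
  have hρ' : ∀ y ∈ U, ContDiffAt ℝ (⊤ : ℕ∞) ρ y := fun y hy => hρ.contDiffAt (hU.mem_nhds hy)
  have hρd : ∀ y ∈ U, DifferentiableAt ℝ ρ y := fun y hy => (hρ' y hy).differentiableAt (by simp)
  have hvol : 0 < volFac g x := volFac_pos (hinv x hx)
  have hvold : DifferentiableAt ℝ (volFac g) x := volFac_differentiableAt
    (fun μ ν => ((hg μ ν).contDiffAt (hU.mem_nhds hx)).differentiableAt (by simp)) hvol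
  have hginvd : ∀ μ ν, DifferentiableAt ℝ (fun y => ginv y μ ν) x :=
    fun μ ν => ((hginv μ ν).contDiffAt (hU.mem_nhds hx)).differentiableAt (by simp)
  set s : (Fin n → ℝ) → ℝ := fun y => Real.sqrt (ρ y) with hs
  have hsx : s x ≠ 0 := (Real.sqrt_pos.2 (hρpos x hx)).ne'
  have hsd : DifferentiableAt ℝ s x := (hρd x hx).sqrt (hρpos x hx).ne'
  have hpds : ∀ j, DifferentiableAt ℝ (pd j s) x :=
    differentiableAt_pd_sqrt (hρ' x hx) (hρpos x hx)
  have hφs : ∀ y ∈ U, ∀ j, φ y j = -(2 / ((n : ℝ) - 2)) * (pd j s y / s y) := by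
    intro y hy j
    rw [hφ, pd_log_eq_pd_sqrt (hρd y hy) (hρpos y hy)]
    ring
  set w : Fin n → (Fin n → ℝ) → ℝ := fun i y => volFac g y * ∑ j, ginv y i j * pd j s y with hw
  have hwd : ∀ i, DifferentiableAt ℝ (w i) x := by
    intro i
    fun_prop
  have hdiv : ∀ i, pd i (fun y => volFac g y * ∑ j, ginv y i j * φ y j) x =
      -(2 / ((n : ℝ) - 2)) * (pd i (w i) x / s x - w i x * pd i s x / s x ^ 2) := by
    intro i
    rw [← pd_const_mul_div _ (hwd i) hsd hsx]
    unfold pd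
    rw [Filter.EventuallyEq.fderiv_eq]
    filter_upwards [hU.mem_nhds hx] with y hy
    simp only [hφs y hy, hw, Finset.mul_sum, Finset.sum_div]
    exact Finset.sum_congr rfl fun j _ => by ring
  have hquad : ∑ i, ∑ j, ginv x i j * φ x i * φ x j =
      (2 / ((n : ℝ) - 2)) ^ 2 * ((volFac g x)⁻¹ * ∑ i, w i x * pd i s x) / s x ^ 2 := by
    simp only [hφs x hx, hw, Finset.mul_sum, Finset.sum_mul, Finset.sum_div]
    refine Finset.sum_congr rfl fun i _ => Finset.sum_congr rfl fun j _ => ?_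
    field_simp
  have hlap : laplaceBeltrami g ginv s x = (volFac g x)⁻¹ * ∑ i, pd i (w i) x := rfl
  rw [hquad, hlap, hγ]
  simp only [hdiv, ← Finset.mul_sum, Finset.sum_sub_distrib, ← Finset.sum_div]
  change _ = _ / s x
  field_simp
  ring
end
end
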